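/- For every n ≥ 1 and every τ ∈ S_n, ∑_{g∈S_n} ĩnv(g)·ĩnv(g⁻¹τ) = −((n+1)!/6)·p₁(τ) − (n!/6)·p₂(τ), where ĩnv = inv − n(n−1)/4 and p₁, p₂ are the components of ĩnv·(composed with translation) in the two eigenspaces; equivalently: the operator of right convolution by inv on ℂ[S_n] has exactly three nonzero eigenvalues, n!·n(n−1)/4, −(n+1)!/6, and −n!/6, with multiplicities 1, n−1, and (n−1)(n−2)/2 respectively. -/

import Mathlib

def descents (n : ℕ) (σ : Equiv.Perm (Fin n)) : Finset (Fin (n - 1)) :=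
  Finset.univ.filter fun i =>
    σ ⟨i.1 + 1, by have := i.isLt; omega⟩ < σ ⟨i.1, by have := i.isLt; omega⟩

def desStat (n : ℕ) (σ : Equiv.Perm (Fin n)) : ℕ := (descents n σ).card

def majStat (n : ℕ) (σ : Equiv.Perm (Fin n)) : ℕ := ∑ i ∈ descents n σ, (i.1 + 1)

def invStat (n : ℕ) (σ : Equiv.Perm (Fin n)) : ℕ :=
  (Finset.univ.filter fun p : Fin n × Fin n => p.1 < p.2 ∧ σ p.2 < σ p.1).card

def fixStat (n : ℕ) (σ : Equiv.Perm (Fin n)) : ℕ :=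
  (Finset.univ.filter fun i : Fin n => σ i = i).card

open Finset

noncomputable def sg {n : ℕ} (i j : Fin n) : ℂ := if i < j then 1 else if j < i then -1 else 0

lemma sg_anti {n : ℕ} (i j : Fin n) : sg j i = - sg i j := by
  unfold sg
  rcases lt_trichotomy i j with h | h | h
  · simp [h, h.not_gt]
  · simp [h]
  · simp [h, h.not_gt]

lemma sg_self {n : ℕ} (i : Fin n) : sg i i = 0 := by simp [sg]

lemma sg_sq {n : ℕ} {i j : Fin n} (h : i ≠ j) : sg i j * sg i j = 1 := by
  unfold sg
  rcases lt_or_gt_of_ne h with h | h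
  · simp [h]
  · simp [h, h.not_gt]

lemma sg_three {n : ℕ} {i j k : Fin n} (h : i ≠ j) (h' : i ≠ k) (h'' : j ≠ k) :
    sg i j * sg i k + sg j i * sg j k + sg k j * sg k i = 1 := by
  unfold sg
  rcases lt_or_gt_of_ne h with h | h <;> rcases lt_or_gt_of_ne h' with h' | h' <;>
    rcases lt_or_gt_of_ne h'' with h'' | h'' <;>
    first
    | (exfalso; omega)
    | simp [h, h', h'', h.not_gt, h'.not_gt, h''.not_gt]

noncomputable def HH {n : ℕ} (a b c d : Fin n) : ℂ :=
  ∑ g : Equiv.Perm (Fin n), sg (g⁻¹ a) (g⁻¹ b) * sg (g⁻¹ c) (g⁻¹ d)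

lemma HH_perm {n : ℕ} (p : Equiv.Perm (Fin n)) (a b c d : Fin n) :
    HH (p a) (p b) (p c) (p d) = HH a b c d := by
  unfold HH
  rw [← Equiv.sum_comp (Equiv.mulLeft p)]
  simp [mul_inv_rev]

lemma HH_anti {n : ℕ} (a b c d : Fin n) : HH b a c d = - HH a b c d := by
  unfold HH
  rw [← Finset.sum_neg_distrib]
  refine Finset.sum_congr rfl fun g _ => ?_
  rw [sg_anti]; ring

lemma HH_symm {n : ℕ} (a b c d : Fin n) : HH a b c d = HH c d a b := by
  unfold HH
  refine Finset.sum_congr rfl fun g _ => ?_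
  ring

lemma HH_anti' {n : ℕ} (a b c d : Fin n) : HH a b d c = - HH a b c d := by
  rw [HH_symm, HH_anti, HH_symm]

lemma HH_same {n : ℕ} (a b : Fin n) (h : a ≠ b) : HH a b a b = n.factorial := by
  unfold HH
  rw [Finset.sum_congr rfl fun g _ => sg_sq (fun e => h ((g⁻¹).injective e))]
  simp [Fintype.card_perm]

lemma HH_disj {n : ℕ} (a b c d : Fin n) (h1 : a ≠ c) (h2 : a ≠ d) (h3 : b ≠ c) (h4 : b ≠ d) :
    HH a b c d = 0 := by
  have h := HH_perm (Equiv.swap a b) a b c d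
  rw [Equiv.swap_apply_left, Equiv.swap_apply_right,
    Equiv.swap_apply_of_ne_of_ne h1.symm h3.symm, Equiv.swap_apply_of_ne_of_ne h2.symm h4.symm,
    HH_anti] at h
  linear_combination (-1/2 : ℂ) * h

lemma HH_three {n : ℕ} (a b c : Fin n) (h1 : a ≠ b) (h2 : a ≠ c) (h3 : b ≠ c) :
    HH a b a c = n.factorial / 3 := by
  have e1 := HH_perm (Equiv.swap a b) a b a c
  rw [Equiv.swap_apply_left, Equiv.swap_apply_right,
    Equiv.swap_apply_of_ne_of_ne h2.symm h3.symm] at e1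
  have e2 := HH_perm (Equiv.swap a c) a b a c
  rw [Equiv.swap_apply_left, Equiv.swap_apply_right,
    Equiv.swap_apply_of_ne_of_ne h1.symm h3] at e2
  have e3 : HH a b a c + HH b a b c + HH c b c a = n.factorial := by
    unfold HH
    rw [← Finset.sum_add_distrib, ← Finset.sum_add_distrib]
    rw [Finset.sum_congr rfl fun g _ => sg_three (fun e => h1 ((g⁻¹).injective e))
      (fun e => h2 ((g⁻¹).injective e)) (fun e => h3 ((g⁻¹).injective e))]
    simp [Fintype.card_perm]
  rw [e1, e2] at e3
  linear_combination (1/3 : ℂ) * e3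

noncomputable def dl {n : ℕ} (i j : Fin n) : ℂ := if i = j then 1 else 0

lemma HH_eq {n : ℕ} (a b c d : Fin n) :
    HH a b c d = n.factorial / 3 *
      (dl a c + dl b d - dl a d - dl b c + dl a c * dl b d - dl a d * dl b c) := by
  by_cases hab : a = b
  · subst hab
    have : HH a a c d = 0 := by simp [HH, sg_self]
    rw [this]; ring
  by_cases hcd : c = d
  · subst hcd
    have : HH a b c c = 0 := by simp [HH, sg_self]
    rw [this]; ring
  by_cases h1 : a = c
  · subst h1
    by_cases h4 : b = d
    · subst h4
      rw [HH_same a b hab]; simp [dl, hab, Ne.symm hab]; ring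
    · rw [HH_three a b d hab hcd h4]; simp [dl, hcd, h4, Ne.symm hab]
  by_cases h2 : a = d
  · subst h2
    rw [HH_anti']
    by_cases h3 : b = c
    · subst h3
      rw [HH_same a b hab]; simp [dl, hab, Ne.symm hab]; ring
    · rw [HH_three a b c hab h1 h3]; simp [dl, h1, h3, Ne.symm hab]
  by_cases h3 : b = c
  · subst h3
    rw [HH_anti, HH_three b a d (Ne.symm h1) hcd h2]; simp [dl, hab, h2, hcd]
  by_cases h4 : b = d
  · subst h4
    rw [HH_anti, HH_anti', HH_three b a c (Ne.symm hab) (Ne.symm hcd) h1]; simp [dl, hab, h1, h3]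
  rw [HH_disj a b c d h1 h2 h3 h4]; simp [dl, h1, h2, h3, h4]

lemma sum_sg_inv {n : ℕ} (g : Equiv.Perm (Fin n)) (f : Fin n → Fin n → ℂ) :
    ∑ a, ∑ b, f a b = ∑ a, ∑ b, f (g a) (g b) := by
  rw [← Equiv.sum_comp g]
  exact Finset.sum_congr rfl fun a _ => (Equiv.sum_comp g _).symm

lemma inv_formula0 {n : ℕ} (s : Equiv.Perm (Fin n)) :
    (invStat n s : ℂ) = n * (n - 1) / 4 - 1 / 4 * ∑ i, ∑ j, sg (s i) (s j) * sg i j := by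
  have h1 : (invStat n s : ℂ) = ∑ i, ∑ j, if i < j ∧ s j < s i then (1 : ℂ) else 0 := by
    unfold invStat
    rw [Finset.card_filter, Fintype.sum_prod_type]
    push_cast
    rfl
  have h2 : (invStat n s : ℂ) = ∑ i, ∑ j, if j < i ∧ s i < s j then (1 : ℂ) else 0 := by
    rw [h1, Finset.sum_comm]
  have h3 : (∑ i : Fin n, ∑ j : Fin n, ((1 : ℂ) - dl i j)) = n * (n - 1) := by
    simp [dl, Finset.sum_sub_distrib]
    ring
  have h4 : (∑ i, ∑ j, if i < j ∧ s j < s i then (1 : ℂ) else 0) +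
      (∑ i, ∑ j, if j < i ∧ s i < s j then (1 : ℂ) else 0) =
      1 / 2 * (∑ i : Fin n, ∑ j : Fin n, ((1 : ℂ) - dl i j)) -
      1 / 2 * ∑ i, ∑ j, sg (s i) (s j) * sg i j := by
    simp only [Finset.mul_sum, ← Finset.sum_add_distrib, ← Finset.sum_sub_distrib]
    refine Finset.sum_congr rfl fun i _ => Finset.sum_congr rfl fun j _ => ?_
    rcases lt_trichotomy i j with h | h | h
    · have hs : s i ≠ s j := fun e => h.ne (s.injective e)
      rcases lt_or_gt_of_ne hs with hs | hs <;>
        simp [sg, dl, h, h.ne, h.not_gt, hs, hs.not_gt] <;> norm_num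
    · subst h; simp [sg, dl]
    · have hs : s i ≠ s j := fun e => h.ne' (s.injective e)
      rcases lt_or_gt_of_ne hs with hs | hs <;>
        simp [sg, dl, h, h.ne', h.not_gt, hs, hs.not_gt] <;> norm_num
  rw [← h1, ← h2, h3] at h4
  linear_combination (1 / 2 : ℂ) * h4

lemma inv_formula {n : ℕ} (g t : Equiv.Perm (Fin n)) :
    (invStat n (g⁻¹ * t) : ℂ) = n * (n - 1) / 4 -
      1 / 4 * ∑ a, ∑ b, sg (g⁻¹ a) (g⁻¹ b) * sg (t⁻¹ a) (t⁻¹ b) := by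
  rw [inv_formula0, sum_sg_inv t (fun a b => sg (g⁻¹ a) (g⁻¹ b) * sg (t⁻¹ a) (t⁻¹ b))]
  simp

abbrev WW (n : ℕ) := ℂ × (Fin n → Fin n → ℂ)

noncomputable def AA (n : ℕ) : (Equiv.Perm (Fin n) → ℂ) →ₗ[ℂ] WW n where
  toFun f := (∑ g, f g, fun a b => ∑ g, f g * sg (g⁻¹ a) (g⁻¹ b))
  map_add' f h := by
    ext <;> simp [Finset.sum_add_distrib, add_mul]
  map_smul' c f := by
    ext <;> simp [Finset.mul_sum, mul_assoc]

noncomputable def BB (n : ℕ) : WW n →ₗ[ℂ] (Equiv.Perm (Fin n) → ℂ) where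
  toFun w := fun t => n * (n - 1) / 4 * w.1 - 1 / 4 * ∑ a, ∑ b, w.2 a b * sg (t⁻¹ a) (t⁻¹ b)
  map_add' f h := by
    ext t; simp [Finset.sum_add_distrib, add_mul]; ring
  map_smul' c f := by
    ext t; simp only [Prod.smul_fst, Prod.smul_snd, Pi.smul_apply, smul_eq_mul, mul_assoc,
      ← Finset.mul_sum, RingHom.id_apply]; ring

lemma M_eq (n : ℕ) (M : Module.End ℂ (Equiv.Perm (Fin n) → ℂ))
    (hM : ∀ (f : Equiv.Perm (Fin n) → ℂ) (τ : Equiv.Perm (Fin n)),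
      M f τ = ∑ g : Equiv.Perm (Fin n), f g * (invStat n (g⁻¹ * τ) : ℂ)) :
    M = BB n ∘ₗ AA n := by
  refine LinearMap.ext fun f => funext fun t => ?_
  rw [hM]
  simp only [inv_formula, BB, AA, LinearMap.comp_apply, LinearMap.coe_mk, AddHom.coe_mk]
  have : ∑ a, ∑ b, (∑ g, f g * sg (g⁻¹ a) (g⁻¹ b)) * sg (t⁻¹ a) (t⁻¹ b)
      = ∑ g, f g * ∑ a, ∑ b, sg (g⁻¹ a) (g⁻¹ b) * sg (t⁻¹ a) (t⁻¹ b) := by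
    simp only [Finset.sum_mul, Finset.mul_sum]
    rw [Finset.sum_congr rfl fun a _ => Finset.sum_comm, Finset.sum_comm]
    simp only [mul_assoc]
  rw [this]
  rw [Finset.mul_sum, Finset.mul_sum, ← Finset.sum_sub_distrib]
  refine Finset.sum_congr rfl fun g _ => ?_
  ring

noncomputable def TT {n : ℕ} (y : Fin n → Fin n → ℂ) (a b : Fin n) : ℂ :=
  -(n.factorial : ℂ) / 12 *
    ((∑ d, y a d) + (∑ c, y c b) - (∑ c, y c a) - (∑ d, y b d) + y a b - y b a)

lemma sum_sg_zero {n : ℕ} (a b : Fin n) :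
    ∑ g : Equiv.Perm (Fin n), sg (g⁻¹ a) (g⁻¹ b) = 0 := by
  by_cases h : a = b
  · subst h; simp [sg_self]
  have h1 : ∑ g : Equiv.Perm (Fin n), sg (g⁻¹ a) (g⁻¹ b) =
      ∑ g : Equiv.Perm (Fin n), sg (g⁻¹ b) (g⁻¹ a) := by
    rw [← Equiv.sum_comp (Equiv.mulLeft (Equiv.swap a b))]
    simp [mul_inv_rev]
  have h2 : ∑ g : Equiv.Perm (Fin n), sg (g⁻¹ b) (g⁻¹ a) =
      - ∑ g : Equiv.Perm (Fin n), sg (g⁻¹ a) (g⁻¹ b) := by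
    rw [← Finset.sum_neg_distrib]
    exact Finset.sum_congr rfl fun g _ => sg_anti _ _
  rw [h2] at h1
  linear_combination (1/2 : ℂ) * h1

lemma sum_HH {n : ℕ} (y : Fin n → Fin n → ℂ) (a b : Fin n) :
    - 1 / 4 * ∑ c, ∑ d, y c d * HH c d a b = TT y a b := by
  have h : ∀ c d, y c d * HH c d a b = n.factorial / 3 *
      ((if c = a then y c d else 0) + (if d = b then y c d else 0) - (if c = b then y c d else 0)
        - (if d = a then y c d else 0) + (if c = a then if d = b then y c d else 0 else 0)
        - (if c = b then if d = a then y c d else 0 else 0)) := by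
    intro c d
    rw [HH_eq]
    unfold dl
    split_ifs <;> ring
  simp only [h, ← Finset.mul_sum, Finset.sum_add_distrib, Finset.sum_sub_distrib]
  have e1 : ∀ a : Fin n, ∑ c, ∑ d, (if c = a then y c d else 0) = ∑ d, y a d := by
    intro a; rw [Finset.sum_comm]; simp
  have e2 : ∀ a b : Fin n, ∑ c, ∑ d, (if c = a then if d = b then y c d else 0 else 0) = y a b := by
    intro a b; rw [Finset.sum_comm]; simp
  simp only [e1, e2, Finset.sum_ite_eq', Finset.mem_univ, if_true]
  unfold TT
  ring

lemma AB_eq (n : ℕ) (w : WW n) :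
    (AA n ∘ₗ BB n) w = ((n.factorial : ℂ) * n * ((n : ℂ) - 1) / 4 * w.1, TT w.2) := by
  simp only [BB, AA, LinearMap.comp_apply, LinearMap.coe_mk, AddHom.coe_mk]
  refine Prod.ext ?_ ?_
  · simp only [Finset.sum_sub_distrib, ← Finset.mul_sum]
    rw [Finset.sum_comm, Finset.sum_congr rfl fun a _ => Finset.sum_comm]
    simp only [← Finset.mul_sum, sum_sg_zero]
    simp [Fintype.card_perm]
    ring
  · funext a b
    simp only [sub_mul, Finset.sum_sub_distrib, mul_assoc, ← Finset.mul_sum, sum_sg_zero]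
    rw [← sum_HH]
    unfold HH
    simp only [Finset.sum_mul, Finset.mul_sum]
    rw [Finset.sum_comm, Finset.sum_congr rfl fun a _ => Finset.sum_comm]
    simp only [mul_zero, zero_sub, ← Finset.sum_neg_distrib]
    refine Finset.sum_congr rfl fun c _ => Finset.sum_congr rfl fun d _ =>
      Finset.sum_congr rfl fun g _ => ?_
    ring

section
variable {V W : Type*} [AddCommGroup V] [Module ℂ V] [AddCommGroup W] [Module ℂ W]

lemma finrank_le_aux [FiniteDimensional ℂ W] (A : V →ₗ[ℂ] W) (B : W →ₗ[ℂ] V) (μ : ℂ) (hμ : μ ≠ 0) :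
    Module.finrank ℂ (Module.End.eigenspace (B ∘ₗ A) μ) ≤
      Module.finrank ℂ (Module.End.eigenspace (A ∘ₗ B) μ) := by
  have hm : ∀ v ∈ Module.End.eigenspace (B ∘ₗ A) μ, A v ∈ Module.End.eigenspace (A ∘ₗ B) μ := by
    intro v hv
    rw [Module.End.mem_eigenspace_iff] at hv ⊢
    have hv' : B (A v) = μ • v := hv
    rw [LinearMap.comp_apply, hv', map_smul]
  refine LinearMap.finrank_le_finrank_of_injective (f := A.restrict hm) ?_
  rw [← LinearMap.ker_eq_bot, LinearMap.ker_eq_bot']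
  rintro ⟨v, hv⟩ h
  have h' : A v = 0 := congrArg Subtype.val h
  rw [Module.End.mem_eigenspace_iff] at hv
  have hv' : B (A v) = μ • v := hv
  rw [h', map_zero] at hv'
  have := (smul_eq_zero.1 hv'.symm).resolve_left hμ
  exact Subtype.ext this

lemma finrank_eq_aux [FiniteDimensional ℂ V] [FiniteDimensional ℂ W] (A : V →ₗ[ℂ] W) (B : W →ₗ[ℂ] V) (μ : ℂ) (hμ : μ ≠ 0) :
    Module.finrank ℂ (Module.End.eigenspace (B ∘ₗ A) μ) =
      Module.finrank ℂ (Module.End.eigenspace (A ∘ₗ B) μ) :=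
  le_antisymm (finrank_le_aux A B μ hμ) (finrank_le_aux B A μ hμ)
end

lemma TT_anti {n : ℕ} (y : Fin n → Fin n → ℂ) (μ : ℂ) (hμ : μ ≠ 0) (h : TT y = μ • y) (a b) :
    y b a = - y a b := by
  have h1 := congrFun (congrFun h a) b
  have h2 := congrFun (congrFun h b) a
  simp only [TT, Pi.smul_apply, smul_eq_mul] at h1 h2
  have : μ * (y b a + y a b) = 0 := by linear_combination - h1 - h2
  have := (mul_eq_zero.1 this).resolve_left hμ
  linear_combination this

lemma TT_of_anti {n : ℕ} (y : Fin n → Fin n → ℂ) (h : ∀ a b, y b a = - y a b) (a b) :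
    TT y a b = -(n.factorial : ℂ) / 6 * ((∑ d, y a d) - (∑ d, y b d) + y a b) := by
  have e : ∀ a, ∑ c, y c a = - ∑ d, y a d := fun a => by
    rw [← Finset.sum_neg_distrib]; exact Finset.sum_congr rfl fun d _ => h _ _
  rw [TT, e, e, h a b]; ring

lemma sum_anti {n : ℕ} (y : Fin n → Fin n → ℂ) (h : ∀ a b, y b a = - y a b) :
    ∑ a, ∑ b, y a b = 0 := by
  have h1 : ∑ a, ∑ b, y a b = - ∑ a, ∑ b, y a b := by
    conv_lhs => rw [Finset.sum_comm]
    simp only [← Finset.sum_neg_distrib]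
    exact Finset.sum_congr rfl fun a _ => Finset.sum_congr rfl fun b _ => h _ _
  linear_combination (1/2 : ℂ) * h1

lemma row_TT {n : ℕ} (y : Fin n → Fin n → ℂ) (h : ∀ a b, y b a = - y a b) (a) :
    ∑ b, TT y a b = -((n + 1).factorial : ℂ) / 6 * ∑ b, y a b := by
  simp only [TT_of_anti y h, ← Finset.mul_sum, Finset.sum_add_distrib, Finset.sum_sub_distrib,
    sum_anti y h]
  simp [Nat.factorial_succ]
  ring

lemma TT_cases {n : ℕ} (y : Fin n → Fin n → ℂ) (μ : ℂ) (hμ : μ ≠ 0) (h : TT y = μ • y) :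
    (μ = -((n + 1).factorial : ℂ) / 6 ∨ (∀ a, ∑ b, y a b = 0)) ∧
    (y = 0 ∨ μ = -((n + 1).factorial : ℂ) / 6 ∨ μ = -(n.factorial : ℂ) / 6) := by
  have ha := TT_anti y μ hμ h
  have h1 : μ = -((n + 1).factorial : ℂ) / 6 ∨ (∀ a, ∑ b, y a b = 0) := by
    by_contra! hc
    obtain ⟨h1, a, h2⟩ := hc
    have := row_TT y ha a
    rw [h] at this
    simp only [Pi.smul_apply, smul_eq_mul, ← Finset.mul_sum] at this
    exact h1 (mul_right_cancel₀ h2 this)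
  refine ⟨h1, ?_⟩
  rcases h1 with h1 | h1
  · exact Or.inr (Or.inl h1)
  by_contra! hc
  refine hc.1 (funext fun a => funext fun b => ?_)
  have h2 := TT_of_anti y ha a b
  rw [h, h1, h1] at h2
  simp only [Pi.smul_apply, smul_eq_mul] at h2
  have : (μ - -(n.factorial : ℂ) / 6) * y a b = 0 := by linear_combination h2
  exact (mul_eq_zero.1 this).resolve_left (sub_ne_zero.2 hc.2.2)

lemma mem_AB (n : ℕ) (μ : ℂ) (w : WW n) : w ∈ Module.End.eigenspace (AA n ∘ₗ BB n) μ ↔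
    (n.factorial : ℂ) * n * ((n : ℂ) - 1) / 4 * w.1 = μ * w.1 ∧ TT w.2 = μ • w.2 := by
  rw [Module.End.mem_eigenspace_iff, AB_eq, Prod.ext_iff]
  rfl

lemma lam_ne (n k : ℕ) : (n.factorial : ℂ) * n * ((n : ℂ) - 1) / 4 ≠ -(k.factorial : ℂ) / 6 := by
  intro h
  have hk := Nat.factorial_pos k
  rcases n with _ | m
  · have : ((k.factorial : ℕ) : ℂ) = 0 := by
      push_cast at h
      linear_combination 6 * h
    have := Nat.cast_eq_zero.1 this
    omega
  · have : (((m + 1).factorial * (m + 1) * m * 6 + 4 * k.factorial : ℕ) : ℂ) = 0 := by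
      push_cast at h ⊢
      linear_combination 24 * h
    have := Nat.cast_eq_zero.1 this
    omega

lemma fac_ne (n : ℕ) : -(n.factorial : ℂ) / 6 ≠ 0 := by
  have : (n.factorial : ℂ) ≠ 0 := Nat.cast_ne_zero.2 (Nat.factorial_ne_zero n)
  intro h
  apply this
  linear_combination (-6) * h

lemma fac_ne_fac (n : ℕ) (hn : 1 ≤ n) : -((n + 1).factorial : ℂ) / 6 ≠ -(n.factorial : ℂ) / 6 := by
  intro h
  have h' : (((n + 1).factorial : ℕ) : ℂ) = n.factorial := by linear_combination (-6) * h
  have := Nat.cast_injective h'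
  rw [Nat.factorial_succ] at this
  have := Nat.factorial_pos n
  nlinarith

lemma rank0 (n : ℕ) (hn : 2 ≤ n) : Module.finrank ℂ (Module.End.eigenspace (AA n ∘ₗ BB n)
    ((n.factorial : ℂ) * n * ((n : ℂ) - 1) / 4)) = 1 := by
  have h0 : (n.factorial : ℂ) * n * ((n : ℂ) - 1) / 4 ≠ 0 := by
    obtain ⟨m, rfl⟩ : ∃ m, n = m + 2 := ⟨n - 2, by omega⟩
    have h1 : ((m + 2).factorial : ℂ) ≠ 0 := Nat.cast_ne_zero.2 (Nat.factorial_ne_zero _)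
    have h2 : ((m + 2 : ℕ) : ℂ) ≠ 0 := Nat.cast_ne_zero.2 (by omega)
    have h3 : ((m + 2 : ℕ) : ℂ) - 1 ≠ 0 := by
      have : ((m + 1 : ℕ) : ℂ) ≠ 0 := Nat.cast_ne_zero.2 (by omega)
      intro h
      apply this
      push_cast at h ⊢
      linear_combination h
    exact div_ne_zero (mul_ne_zero (mul_ne_zero h1 h2) h3) (by norm_num)
  refine finrank_eq_one_iff'.2 ⟨⟨((1 : ℂ), 0), ?_⟩, ?_, ?_⟩
  · rw [mem_AB]
    refine ⟨rfl, ?_⟩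
    funext a b
    simp [TT]
  · intro h
    have := congrArg (fun w => w.1.1) h
    simp at this
  · rintro ⟨⟨s, y⟩, hw⟩
    refine ⟨s, Subtype.ext ?_⟩
    rw [mem_AB] at hw
    have hy : y = 0 := by
      rcases (TT_cases y _ h0 hw.2).2 with h | h | h
      · exact h
      · exact absurd h (lam_ne n (n + 1))
      · exact absurd h (lam_ne n n)
    subst hy
    simp

noncomputable def sumF (n : ℕ) : (Fin n → ℂ) →ₗ[ℂ] ℂ := ∑ i, LinearMap.proj i

lemma sumF_apply (n : ℕ) (r : Fin n → ℂ) : sumF n r = ∑ i, r i := by simp [sumF]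

lemma rank_sumF (n : ℕ) (hn : 1 ≤ n) : Module.finrank ℂ (LinearMap.ker (sumF n)) = n - 1 := by
  have h := LinearMap.finrank_range_add_finrank_ker (sumF n)
  have h2 : LinearMap.range (sumF n) = ⊤ := by
    rw [LinearMap.range_eq_top]
    intro c
    refine ⟨Pi.single ⟨0, hn⟩ c, ?_⟩
    rw [sumF_apply]
    simp
  rw [h2, finrank_top] at h
  simp at h
  omega

lemma w1_zero {n k : ℕ} {w : WW n}
    (h : w ∈ Module.End.eigenspace (AA n ∘ₗ BB n) (-(k.factorial : ℂ) / 6)) : w.1 = 0 := by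
  rw [mem_AB] at h
  have := h.1
  by_contra hc
  exact lam_ne n k (mul_right_cancel₀ hc this)

lemma anti_of_mem {n k : ℕ} {w : WW n}
    (h : w ∈ Module.End.eigenspace (AA n ∘ₗ BB n) (-(k.factorial : ℂ) / 6)) (a b) :
    w.2 b a = - w.2 a b := by
  rw [mem_AB] at h
  exact TT_anti _ _ (fac_ne k) h.2 a b

noncomputable def rowL (n : ℕ) : Module.End.eigenspace (AA n ∘ₗ BB n)
    (-((n + 1).factorial : ℂ) / 6) →ₗ[ℂ] LinearMap.ker (sumF n) where
  toFun w := ⟨fun a => ∑ b, w.1.2 a b, by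
    rw [LinearMap.mem_ker, sumF_apply]
    exact sum_anti _ (anti_of_mem w.2)⟩
  map_add' f h := by
    ext; simp [Finset.sum_add_distrib]
  map_smul' c f := by
    ext; simp [Finset.mul_sum]

lemma rank1 (n : ℕ) (hn : 1 ≤ n) : Module.finrank ℂ (Module.End.eigenspace (AA n ∘ₗ BB n)
    (-((n + 1).factorial : ℂ) / 6)) = n - 1 := by
  rw [← rank_sumF n hn]
  have hn0 : (n : ℂ) ≠ 0 := Nat.cast_ne_zero.2 (by omega)
  refine LinearEquiv.finrank_eq (LinearEquiv.ofBijective (rowL n) ⟨?_, ?_⟩)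
  · rw [← LinearMap.ker_eq_bot, LinearMap.ker_eq_bot']
    rintro ⟨⟨s, y⟩, hw⟩ h
    have hr : ∀ a, ∑ b, y a b = 0 := fun a => congrFun (congrArg Subtype.val h) a
    have hs : s = 0 := w1_zero hw
    have ha : ∀ a b, y b a = - y a b := anti_of_mem hw
    rw [mem_AB] at hw
    refine Subtype.ext (Prod.ext hs (funext fun a => funext fun b => ?_))
    have h2 := TT_of_anti y ha a b
    have h3 : TT y = _ := hw.2
    rw [h3, hr, hr] at h2
    simp only [Pi.smul_apply, smul_eq_mul] at h2
    have : (-((n + 1).factorial : ℂ) / 6 - -(n.factorial : ℂ) / 6) * y a b = 0 := by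
      linear_combination h2
    exact (mul_eq_zero.1 this).resolve_left (sub_ne_zero.2 (fac_ne_fac n hn))
  · rintro ⟨r, hr⟩
    rw [LinearMap.mem_ker, sumF_apply] at hr
    have hrow : ∀ a, ∑ b, (r a - r b) / (n : ℂ) = r a := by
      intro a
      rw [← Finset.sum_div, Finset.sum_sub_distrib, hr]
      simp
      field_simp
    refine ⟨⟨((0 : ℂ), fun a b => (r a - r b) / n), ?_⟩, ?_⟩
    · rw [mem_AB]
      refine ⟨by simp, ?_⟩
      funext a b
      rw [TT_of_anti _ (fun a b => by ring)]
      simp only [hrow, Pi.smul_apply, smul_eq_mul, Nat.factorial_succ]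
      push_cast
      field_simp
    · exact Subtype.ext (funext fun a => hrow a)

noncomputable def resL (m : ℕ) : Module.End.eigenspace (AA (m + 1) ∘ₗ BB (m + 1))
    (-((m + 1).factorial : ℂ) / 6) →ₗ[ℂ] ({p : Fin m × Fin m // p.1 < p.2} → ℂ) where
  toFun w := fun p => w.1.2 p.1.1.succ p.1.2.succ
  map_add' f h := by
    ext; simp
  map_smul' c f := by
    ext; simp

lemma card_pairs (m : ℕ) : Fintype.card {p : Fin m × Fin m // p.1 < p.2} = m * (m - 1) / 2 := by
  rw [Fintype.card_subtype, Finset.card_filter, Fintype.sum_prod_type, Finset.sum_comm,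
    ← Finset.sum_range_id, ← Fin.sum_univ_eq_sum_range (fun i => i)]
  refine Finset.sum_congr rfl fun j _ => ?_
  rw [← Finset.card_filter]
  have : (univ.filter fun x => x < j) = Finset.Iio j := by ext; simp
  rw [this, Fin.card_Iio]

noncomputable def YY {m : ℕ} (z : {p : Fin m × Fin m // p.1 < p.2} → ℂ) (a b : Fin m) : ℂ :=
  if h : a < b then z ⟨(a, b), h⟩ else if h : b < a then - z ⟨(b, a), h⟩ else 0

lemma YY_anti {m : ℕ} (z : {p : Fin m × Fin m // p.1 < p.2} → ℂ) (a b : Fin m) :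
    YY z b a = - YY z a b := by
  unfold YY
  rcases lt_trichotomy a b with h | h | h
  · simp [h, h.not_gt]
  · simp [h]
  · simp [h, h.not_gt]

noncomputable def EE {m : ℕ} (Y : Fin m → Fin m → ℂ) : Fin (m + 1) → Fin (m + 1) → ℂ :=
  Fin.cons (Fin.cons 0 fun b => ∑ c, Y b c) fun a => Fin.cons (- ∑ c, Y a c) fun b => Y a b

lemma rank2 (m : ℕ) : Module.finrank ℂ (Module.End.eigenspace (AA (m + 1) ∘ₗ BB (m + 1))
    (-((m + 1).factorial : ℂ) / 6)) = m * (m - 1) / 2 := by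
  rw [← card_pairs, ← Module.finrank_fintype_fun_eq_card ℂ]
  refine LinearEquiv.finrank_eq (LinearEquiv.ofBijective (resL m) ⟨?_, ?_⟩)
  · rw [← LinearMap.ker_eq_bot, LinearMap.ker_eq_bot']
    rintro ⟨⟨s, y⟩, hw⟩ h
    have hr : ∀ a b : Fin m, a < b → y a.succ b.succ = 0 := fun a b hab => congrFun h ⟨(a, b), hab⟩
    have hs : s = 0 := w1_zero hw
    have ha : ∀ a b, y b a = - y a b := anti_of_mem hw
    rw [mem_AB] at hw
    have hd : ∀ a, y a a = 0 := fun a => by linear_combination (1/2 : ℂ) * ha a a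
    have hsu : ∀ a b : Fin m, y a.succ b.succ = 0 := by
      intro a b
      rcases lt_trichotomy a b with h | h | h
      · exact hr a b h
      · subst h; exact hd _
      · rw [ha, hr b a h, neg_zero]
    have hrow : ∀ a, ∑ b, y a b = 0 := by
      rcases (TT_cases y _ (fac_ne (m + 1)) hw.2).1 with h | h
      · exact absurd h.symm (fac_ne_fac (m + 1) (by omega))
      · exact h
    have h0 : ∀ a : Fin m, y a.succ 0 = 0 := by
      intro a
      have := hrow a.succ
      rw [Fin.sum_univ_succ] at this
      simpa [hsu] using this
    refine Subtype.ext (Prod.ext hs (funext fun a => funext fun b => ?_))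
    change y a b = 0
    refine Fin.cases ?_ (fun a => ?_) a <;> refine Fin.cases ?_ (fun b => ?_) b
    · exact hd 0
    · rw [ha, h0, neg_zero]
    · exact h0 a
    · exact hsu a b
  · intro z
    have hA : ∀ a b, EE (YY z) b a = - EE (YY z) a b := by
      intro a b
      refine Fin.cases ?_ (fun a => ?_) a <;> refine Fin.cases ?_ (fun b => ?_) b
      · simp [EE]
      · simp [EE]
      · simp [EE]
      · simpa [EE] using YY_anti z a b
    have hR : ∀ a, ∑ b, EE (YY z) a b = 0 := by
      intro a
      refine Fin.cases ?_ (fun a => ?_) a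
      · rw [Fin.sum_univ_succ]
        simpa [EE] using sum_anti _ (YY_anti z)
      · rw [Fin.sum_univ_succ]
        simp [EE]
    refine ⟨⟨((0 : ℂ), EE (YY z)), ?_⟩, ?_⟩
    · rw [mem_AB]
      refine ⟨by simp, ?_⟩
      funext a b
      rw [TT_of_anti _ hA, hR, hR]
      simp
    · funext p
      obtain ⟨⟨a, b⟩, h⟩ := p
      have h' : a < b := h
      change EE (YY z) a.succ b.succ = _
      simp [EE, YY, h']

theorem inv_convolution_spectrum (n : ℕ) (hn : 1 ≤ n)
    (M : Module.End ℂ (Equiv.Perm (Fin n) → ℂ))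
    (hM : ∀ (f : Equiv.Perm (Fin n) → ℂ) (τ : Equiv.Perm (Fin n)),
      M f τ = ∑ g : Equiv.Perm (Fin n), f g * (invStat n (g⁻¹ * τ) : ℂ)) :
    Module.finrank ℂ
        (Module.End.eigenspace M ((n.factorial : ℂ) * n * ((n : ℂ) - 1) / 4)) = 1 ∧
    Module.finrank ℂ
        (Module.End.eigenspace M (-((n + 1).factorial : ℂ) / 6)) = n - 1 ∧
    Module.finrank ℂ
        (Module.End.eigenspace M (-(n.factorial : ℂ) / 6)) = (n - 1) * (n - 2) / 2 ∧
    ∀ μ : ℂ, M.HasEigenvalue μ →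
      μ = 0 ∨ μ = (n.factorial : ℂ) * n * ((n : ℂ) - 1) / 4 ∨
        μ = -((n + 1).factorial : ℂ) / 6 ∨ μ = -(n.factorial : ℂ) / 6 := by
  have hMe := M_eq n M hM
  subst hMe
  refine ⟨?_, ?_, ?_, ?_⟩
  · rcases Nat.lt_or_ge n 2 with h | h
    · obtain rfl : n = 1 := by omega
      have : Module.End.eigenspace (BB 1 ∘ₗ AA 1)
          (((Nat.factorial 1 : ℕ) : ℂ) * (1 : ℕ) * (((1 : ℕ) : ℂ) - 1) / 4) = ⊤ := by
        rw [eq_top_iff]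
        intro f _
        rw [Module.End.mem_eigenspace_iff]
        funext t
        rw [hM]
        have hz : ∀ s : Equiv.Perm (Fin 1), invStat 1 s = 0 := by
          intro s
          unfold invStat
          rw [Finset.card_eq_zero, Finset.filter_eq_empty_iff]
          rintro ⟨a, b⟩ _ ⟨h1, _⟩
          exact absurd (Subsingleton.elim a b) h1.ne
        simp [hz]
      rw [this, finrank_top]
      simp
    · rw [finrank_eq_aux, rank0 n h]
      intro h0
      have h1 : (n.factorial : ℂ) ≠ 0 := Nat.cast_ne_zero.2 (Nat.factorial_ne_zero n)
      have h2 : (n : ℂ) ≠ 0 := Nat.cast_ne_zero.2 (by omega)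
      have h3 : (n : ℂ) - 1 ≠ 0 := by
        rw [sub_ne_zero]
        exact_mod_cast (by omega : n ≠ 1)
      exact div_ne_zero (mul_ne_zero (mul_ne_zero h1 h2) h3) (by norm_num) h0
  · rw [finrank_eq_aux _ _ _ (fac_ne (n + 1)), rank1 n hn]
  · obtain ⟨m, rfl⟩ : ∃ m, n = m + 1 := ⟨n - 1, by omega⟩
    rw [finrank_eq_aux _ _ _ (fac_ne (m + 1)), rank2 m]
    rfl
  · intro μ hμ
    by_cases h0 : μ = 0
    · exact Or.inl h0
    right
    obtain ⟨f, hf, hf0⟩ := hμ.exists_hasEigenvector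
    rw [Module.End.mem_eigenspace_iff] at hf
    have hf' : BB n (AA n f) = μ • f := hf
    have hw : AA n f ∈ Module.End.eigenspace (AA n ∘ₗ BB n) μ := by
      rw [Module.End.mem_eigenspace_iff, LinearMap.comp_apply, hf', map_smul]
    have hne : AA n f ≠ 0 := by
      intro h
      rw [h, map_zero] at hf'
      exact hf0 ((smul_eq_zero.1 hf'.symm).resolve_left h0)
    rw [mem_AB] at hw
    by_cases h1 : (AA n f).1 = 0
    · rcases (TT_cases _ μ h0 hw.2).2 with h | h | h
      · exact absurd (Prod.ext h1 h) hne
      · exact Or.inr (Or.inl h)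
      · exact Or.inr (Or.inr h)
    · exact Or.inl (mul_right_cancel₀ h1 hw.1).symm
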